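/- arXiv:2510.09054 — 6 statements merged into one kernel-verified Lean document; each statement's English description precedes it below -/
import Mathlib

section
/- Let N be a positive integer, C an invertible N×N complex matrix with C² = I, π an N×N complex matrix with π² = π and C·πᵀ·C = π, and α a nonzero complex number. Then for every λ ∈ ℂ with λ ≠ α and λ ≠ −α, one has C · (k_{α,π}(−λ))ᵀ · C = k_{−α,π}(λ), i.e. C · (k_{α,π}(−λ))ᵀ · C equals the inverse of k_{α,π}(λ). In other words, k_{α,π} satisfies the twisted reality condition σ(k_{α,π}(−λ)) = k_{α,π}(λ), where σ(Y) := (C Yᵀ C^{-1})^{-1}. -/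
open Matrix

/-- If `C` is invertible with `C² = I`, `P` is a projection with `C Pᵀ C = P`,
and `α ≠ 0`, then for `λ ≠ ±α` the simple element `k_{α,P}` satisfies the twisted reality
condition: `C (k_{α,P}(-λ))ᵀ C = k_{-α,P}(λ)`, which is the inverse of `k_{α,P}(λ)`. -/
theorem simple_element_reality (N : ℕ) (hN : 0 < N)
    (C P : Matrix (Fin N) (Fin N) ℂ) (hC : IsUnit C.det) (hC2 : C * C = 1)
    (hP : P * P = P) (hCP : C * Pᵀ * C = P)
    (α : ℂ) (hα : α ≠ 0) (lam : ℂ) (h1 : lam ≠ α) (h2 : lam ≠ -α) :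
    C * ((1 : Matrix (Fin N) (Fin N) ℂ) + (2 * α / (-lam - α)) • (1 - P))ᵀ * C =
      (1 : Matrix (Fin N) (Fin N) ℂ) + (-2 * α / (lam + α)) • (1 - P) ∧
    (C * ((1 : Matrix (Fin N) (Fin N) ℂ) + (2 * α / (-lam - α)) • (1 - P))ᵀ * C) *
      ((1 : Matrix (Fin N) (Fin N) ℂ) + (2 * α / (lam - α)) • (1 - P)) = 1 := by
  have hconj (c : ℂ) : C * ((1 : Matrix (Fin N) (Fin N) ℂ) + c • (1 - P))ᵀ * C =
      1 + c • (1 - P) := by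
    simp only [transpose_add, transpose_smul, transpose_sub, transpose_one, mul_add, add_mul,
      mul_sub, sub_mul, mul_smul_comm, smul_mul_assoc, mul_one, hC2, hCP]
  have hsub : lam - α ≠ 0 := sub_ne_zero.mpr h1
  have hadd : lam + α ≠ 0 := fun h => h2 (eq_neg_of_add_eq_zero_left h)
  have hcoeff : 2 * α / (-lam - α) = -2 * α / (lam + α) := by
    rw [show -lam - α = -(lam + α) by ring, div_neg, neg_mul, neg_div]
  rw [hconj, hcoeff]
  refine ⟨rfl, ?_⟩
  have hQ : (1 - P) * (1 - P) = 1 - P := (show IsIdempotentElem P from hP).one_sub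
  have hzero : -2 * α / (lam + α) + 2 * α / (lam - α) +
      -2 * α / (lam + α) * (2 * α / (lam - α)) = 0 := by
    field_simp
    ring
  generalize -2 * α / (lam + α) = a at hzero ⊢
  generalize 2 * α / (lam - α) = b at hzero ⊢
  calc (1 + a • (1 - P)) * (1 + b • (1 - P))
      = 1 + (a + b + a * b) • (1 - P) := by
        rw [add_mul, mul_add, mul_add, smul_mul_smul_comm, hQ, one_mul, one_mul, mul_one]
        module
    _ = 1 := by rw [hzero, zero_smul, add_zero]
end

section
/- Let N be a positive integer, α₁, α₂ nonzero complex numbers with α₁ ≠ α₂, and π₁, π₂ N×N complex matrices with π₁² = π₁ and π₂² = π₂. Suppose the matrix φ := (α₁−α₂)·I + 2α₂·π₂ − 2α₁·π₁ is invertible. Then the range of τ₁ := φ π₁ φ^{-1} equals the image under k_{α₂,π₂}(α₁) of the range of π₁; that is, Im(φ π₁ φ^{-1}) = k_{α₂,π₂}(α₁)(Im π₁), where k_{α₂,π₂}(α₁) = I + (2α₂/(α₁−α₂))·(I−π₂). -/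
open Matrix

/-- part (3) of Proposition `prop_alpha_tau`: with
`φ = (α₁-α₂)I + 2α₂π₂ - 2α₁π₁` invertible and `τ₁ = φ π₁ φ⁻¹`,
`Im τ₁ = k_{α₂,π₂}(α₁)(Im π₁)`. -/
theorem range_of_conjugated_projection (N : ℕ) (hN : 0 < N)
    (α₁ α₂ : ℂ) (h1 : α₁ ≠ 0) (h2 : α₂ ≠ 0) (h12 : α₁ ≠ α₂)
    (P₁ P₂ : Matrix (Fin N) (Fin N) ℂ) (hP1 : P₁ * P₁ = P₁) (hP2 : P₂ * P₂ = P₂)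
    (φ : Matrix (Fin N) (Fin N) ℂ)
    (hφdef : φ = (α₁ - α₂) • (1 : Matrix (Fin N) (Fin N) ℂ) + (2 * α₂) • P₂ - (2 * α₁) • P₁)
    (hφ : IsUnit φ.det)
    (τ₁ : Matrix (Fin N) (Fin N) ℂ) (hτ1 : τ₁ = φ * P₁ * φ⁻¹) :
    Set.range τ₁.mulVec =
      ((1 : Matrix (Fin N) (Fin N) ℂ) + (2 * α₂ / (α₁ - α₂)) • (1 - P₂)).mulVec ''
        Set.range P₁.mulVec := by
  have hc : α₁ - α₂ ≠ 0 := sub_ne_zero.mpr h12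
  have hc' : α₂ - α₁ ≠ 0 := sub_ne_zero.mpr h12.symm
  set K := (1 : Matrix (Fin N) (Fin N) ℂ) + (2 * α₂ / (α₁ - α₂)) • (1 - P₂) with hK
  have key : φ * P₁ = (α₂ - α₁) • (K * P₁) := by
    rw [hφdef, hK]
    simp only [add_mul, sub_mul, Matrix.smul_mul, one_mul, hP1]
    match_scalars <;> field_simp <;> ring
  subst hτ1
  ext y
  simp only [Set.mem_range, Set.mem_image, exists_exists_eq_and, Matrix.mulVec_mulVec]
  constructor
  · rintro ⟨x, rfl⟩
    refine ⟨(α₂ - α₁) • (φ⁻¹ *ᵥ x), ?_⟩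
    rw [key, Matrix.mulVec_smul, Matrix.mulVec_mulVec, Matrix.smul_mul, Matrix.smul_mulVec]
  · rintro ⟨x, rfl⟩
    refine ⟨φ *ᵥ ((α₂ - α₁)⁻¹ • x), ?_⟩
    rw [Matrix.mulVec_mulVec, mul_assoc, Matrix.nonsing_inv_mul _ hφ, mul_one, key,
      Matrix.mulVec_smul, Matrix.smul_mulVec, inv_smul_smul₀ hc']
end

section
/- Let N be a positive integer, α₁, α₂ nonzero complex numbers with α₁ ≠ α₂, and π₁, π₂ N×N complex matrices with π₁² = π₁ and π₂² = π₂. Suppose that φ := (α₁−α₂)·I + 2α₂·π₂ − 2α₁·π₁ is invertible, and set τ₁ := φ π₁ φ^{-1} and τ₂ := φ π₂ φ^{-1}. Then for every λ ∈ ℂ with λ ≠ α₁ and λ ≠ α₂, the permutability identity k_{α₂,τ₂}(λ) · k_{α₁,π₁}(λ) = k_{α₁,τ₁}(λ) · k_{α₂,π₂}(λ) holds. -/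
open Matrix

/-- If `u` is a unit with inverse `v` and `u = a - b`, then
`(l + u b v) (l + a) = (l + u a v) (l + b)` for every scalar `l`. -/
theorem smul_one_add_conj_mul_comm {R A : Type*} [CommRing R] [Ring A] [Algebra R A]
    {a b u v : A} (hu : u = a - b) (huv : u * v = 1) (hvu : v * u = 1) (l : R) :
    (l • (1 : A) + u * b * v) * (l • (1 : A) + a) =
      (l • (1 : A) + u * a * v) * (l • (1 : A) + b) := by
  have ha : a = u + b := by rw [hu, sub_add_cancel]
  have hconj : u * a * v = u + u * b * v := by
    rw [ha, mul_add, add_mul, mul_assoc u u v, huv, mul_one]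
  have hcancel : u * b * v * u = u * b := by rw [mul_assoc, hvu, mul_one]
  rw [hconj, ha]
  simp only [mul_add, add_mul, hcancel, smul_mul_assoc, mul_smul_comm, smul_add, one_mul,
    mul_one]
  abel

/-- A simple element as a scalar multiple of an affine function of the spectral parameter. -/
theorem one_add_smul_one_sub_eq {K A : Type*} [Field K] [Ring A] [Algebra K A]
    {α l : K} (hl : l ≠ α) (p : A) :
    1 + (2 * α / (l - α)) • (1 - p) =
      (l - α)⁻¹ • (l • (1 : A) + (α • (1 : A) - (2 * α) • p)) := by
  have h : l - α ≠ 0 := sub_ne_zero.mpr hl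
  match_scalars
  · field_simp
    ring
  · field_simp

/-- part (4) of Proposition `prop_alpha_tau`, the permutability identity
`k_{α₂,τ₂}(λ) k_{α₁,π₁}(λ) = k_{α₁,τ₁}(λ) k_{α₂,π₂}(λ)` where `τᵢ = φ πᵢ φ⁻¹` and
`φ = (α₁-α₂)I + 2α₂π₂ - 2α₁π₁`. -/
theorem permutability_of_simple_elements (N : ℕ) (hN : 0 < N)
    (α₁ α₂ : ℂ) (h1 : α₁ ≠ 0) (h2 : α₂ ≠ 0) (h12 : α₁ ≠ α₂)
    (P₁ P₂ : Matrix (Fin N) (Fin N) ℂ) (hP1 : P₁ * P₁ = P₁) (hP2 : P₂ * P₂ = P₂)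
    (φ : Matrix (Fin N) (Fin N) ℂ)
    (hφdef : φ = (α₁ - α₂) • (1 : Matrix (Fin N) (Fin N) ℂ) + (2 * α₂) • P₂ - (2 * α₁) • P₁)
    (hφ : IsUnit φ.det)
    (τ₁ τ₂ : Matrix (Fin N) (Fin N) ℂ)
    (hτ1 : τ₁ = φ * P₁ * φ⁻¹) (hτ2 : τ₂ = φ * P₂ * φ⁻¹)
    (lam : ℂ) (hl1 : lam ≠ α₁) (hl2 : lam ≠ α₂) :
    ((1 : Matrix (Fin N) (Fin N) ℂ) + (2 * α₂ / (lam - α₂)) • (1 - τ₂)) *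
      ((1 : Matrix (Fin N) (Fin N) ℂ) + (2 * α₁ / (lam - α₁)) • (1 - P₁)) =
    ((1 : Matrix (Fin N) (Fin N) ℂ) + (2 * α₁ / (lam - α₁)) • (1 - τ₁)) *
      ((1 : Matrix (Fin N) (Fin N) ℂ) + (2 * α₂ / (lam - α₂)) • (1 - P₂)) := by
  have huv : φ * φ⁻¹ = 1 := mul_nonsing_inv φ hφ
  have hvu : φ⁻¹ * φ = 1 := nonsing_inv_mul φ hφ
  have hconj (α : ℂ) (P : Matrix (Fin N) (Fin N) ℂ) :
      α • (1 : Matrix (Fin N) (Fin N) ℂ) - (2 * α) • (φ * P * φ⁻¹) =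
        φ * (α • 1 - (2 * α) • P) * φ⁻¹ := by
    simp only [mul_sub, sub_mul, mul_smul_comm, smul_mul_assoc, mul_one, huv]
  have hφ' : φ = (α₁ • 1 - (2 * α₁) • P₁) - (α₂ • 1 - (2 * α₂) • P₂) := by
    rw [hφdef, sub_smul]
    abel
  rw [one_add_smul_one_sub_eq hl1, one_add_smul_one_sub_eq hl1, one_add_smul_one_sub_eq hl2,
    one_add_smul_one_sub_eq hl2, hτ1, hτ2, hconj, hconj, smul_mul_smul_comm, smul_mul_smul_comm,
    smul_one_add_conj_mul_comm hφ' huv hvu lam, mul_comm (lam - α₂)⁻¹]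
end

section
/- Let m ≥ 0 and n ≥ 0 be integers and set N := 2m+2n+1. Let C := C_{m,n} = diag(α_m, β_n) with α_m := Σ_{i=1}^{2m} e_{i,2m+1−i} and β_n := Σ_{i=1}^{2n+1} (−1)^{n+i−1} e_{i,2n+2−i}, and let D := D_{m,n}(r) := diag(rⁿ·I_{2m}, 1, r, …, r^{2n}) for a nonzero complex number r. Let π be an N×N complex matrix with π² = π and C·πᵀ·C = π. Then r·π := D π D^{-1} satisfies (r·π)² = r·π and C·(r·π)ᵀ·C = r·π, and the range of r·π equals D(Im π), the image of the range of π under D. -/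
open Matrix

/-- The matrix `C_{m,n} = diag(α_m, β_n)` where `α_m = Σ_{i=1}^{2m} e_{i,2m+1-i}` and
`β_n = Σ_{i=1}^{2n+1} (-1)^{n+i-1} e_{i,2n+2-i}`. -/
def Cmn (m n : ℕ) : Matrix (Fin (2*m+2*n+1)) (Fin (2*m+2*n+1)) ℂ :=
  Matrix.of fun i j =>
    if (i : ℕ) < 2*m then (if (i : ℕ) + (j : ℕ) + 1 = 2*m then 1 else 0)
    else (if (i : ℕ) + (j : ℕ) = 4*m + 2*n then (-1 : ℂ)^(n + ((i : ℕ) - 2*m)) else 0)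

/-- The diagonal matrix `D_{m,n}(r) = diag(rⁿ I_{2m}, 1, r, r², …, r^{2n})`. -/
def Dmn (m n : ℕ) (r : ℂ) : Matrix (Fin (2*m+2*n+1)) (Fin (2*m+2*n+1)) ℂ :=
  Matrix.diagonal fun i => if (i : ℕ) < 2*m then r^n else r^((i : ℕ) - 2*m)

/-- The dilation `D` rescales the bilinear form defined by `C` by the factor `r ^ (2 * n)`. -/
lemma Dmn_mul_Cmn_mul_Dmn (m n : ℕ) (r : ℂ) :
    Dmn m n r * Cmn m n * Dmn m n r = r ^ (2 * n) • Cmn m n := by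
  ext i j
  rw [Dmn, Matrix.mul_diagonal, Matrix.diagonal_mul, Matrix.smul_apply, smul_eq_mul]
  simp only [Cmn, Matrix.of_apply]
  by_cases hi : (i : ℕ) < 2 * m
  · by_cases hij : (i : ℕ) + j + 1 = 2 * m
    · have hj : (j : ℕ) < 2 * m := by omega
      simp only [hi, hj, hij, if_true]
      ring
    · simp [hi, hij]
  · by_cases hij : (i : ℕ) + j = 4 * m + 2 * n
    · have hj : ¬ (j : ℕ) < 2 * m := by omega
      have hpow : r ^ (2 * n) = r ^ ((i : ℕ) - 2 * m) * r ^ ((j : ℕ) - 2 * m) := by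
        rw [← pow_add]
        congr 1
        omega
      simp only [hi, hj, hij, if_true, if_false]
      rw [hpow]
      ring
    · simp [hi, hij]

lemma transpose_Dmn (m n : ℕ) (r : ℂ) : (Dmn m n r)ᵀ = Dmn m n r :=
  Matrix.diagonal_transpose _

lemma isUnit_det_Dmn (m n : ℕ) {r : ℂ} (hr : r ≠ 0) : IsUnit (Dmn m n r).det := by
  rw [Dmn, Matrix.det_diagonal, isUnit_iff_ne_zero, Finset.prod_ne_zero_iff]
  intro i _
  split_ifs <;> exact pow_ne_zero _ hr

lemma Dmn_mul_Cmn (m n : ℕ) {r : ℂ} (hr : r ≠ 0) :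
    Dmn m n r * Cmn m n = r ^ (2 * n) • (Cmn m n * (Dmn m n r)⁻¹) := by
  rw [← Matrix.smul_mul, ← Dmn_mul_Cmn_mul_Dmn,
    Matrix.mul_nonsing_inv_cancel_right _ _ (isUnit_det_Dmn m n hr)]

/-- if `π` is an `O(m+n+1,m+n)` projection (`π² = π`, `C πᵀ C = π`) then
`r·π := D π D⁻¹` is again an `O(m+n+1,m+n)` projection, and its range is `D(Im π)`. -/
theorem scaled_projection (m n : ℕ) (r : ℂ) (hr : r ≠ 0)
    (π' : Matrix (Fin (2*m+2*n+1)) (Fin (2*m+2*n+1)) ℂ)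
    (hproj : π' * π' = π') (hadj : Cmn m n * π'ᵀ * Cmn m n = π') :
    (Dmn m n r * π' * (Dmn m n r)⁻¹) * (Dmn m n r * π' * (Dmn m n r)⁻¹)
        = Dmn m n r * π' * (Dmn m n r)⁻¹ ∧
    Cmn m n * (Dmn m n r * π' * (Dmn m n r)⁻¹)ᵀ * Cmn m n
        = Dmn m n r * π' * (Dmn m n r)⁻¹ ∧
    Set.range (Dmn m n r * π' * (Dmn m n r)⁻¹).mulVec
        = (Dmn m n r).mulVec '' Set.range π'.mulVec := by
  have hD := isUnit_det_Dmn m n hr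
  have hDC := Dmn_mul_Cmn m n hr
  have hT := transpose_Dmn m n r
  generalize Dmn m n r = D at *
  generalize Cmn m n = C at *
  refine ⟨?_, ?_, ?_⟩
  · calc D * π' * D⁻¹ * (D * π' * D⁻¹) = D * π' * (D⁻¹ * D) * π' * D⁻¹ := by
          simp only [Matrix.mul_assoc]
      _ = D * (π' * π') * D⁻¹ := by
          rw [Matrix.nonsing_inv_mul _ hD, Matrix.mul_one, Matrix.mul_assoc D]
      _ = D * π' * D⁻¹ := by rw [hproj]
  · calc C * (D * π' * D⁻¹)ᵀ * C = C * D⁻¹ * π'ᵀ * (D * C) := by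
          simp only [Matrix.transpose_mul, Matrix.transpose_nonsing_inv, hT, Matrix.mul_assoc]
      _ = r ^ (2 * n) • (C * D⁻¹) * π'ᵀ * (C * D⁻¹) := by
          rw [hDC, Matrix.mul_smul, Matrix.smul_mul, Matrix.smul_mul]
      _ = D * (C * π'ᵀ * C) * D⁻¹ := by rw [← hDC]; simp only [Matrix.mul_assoc]
      _ = D * π' * D⁻¹ := by rw [hadj]
  · have hsurj : Function.Surjective D⁻¹.mulVec := fun v =>
      ⟨D *ᵥ v, by rw [Matrix.mulVec_mulVec, Matrix.nonsing_inv_mul _ hD, Matrix.one_mulVec]⟩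
    have hcomp : (D * π' * D⁻¹).mulVec = (D.mulVec ∘ π'.mulVec) ∘ D⁻¹.mulVec := by
      funext v
      simp only [Function.comp_apply, Matrix.mulVec_mulVec, Matrix.mul_assoc]
    rw [hcomp, hsurj.range_comp, Set.range_comp]
end

section
/- Let N be a positive integer, π an N×N complex matrix, D an invertible N×N complex matrix, and s a nonzero complex number. Then for every λ ∈ ℂ with s·λ ≠ 1, D · k_{1,π}(sλ) · D^{-1} = k_{s^{-1}, DπD^{-1}}(λ); explicitly, D·(I + (2/(sλ−1))(I−π))·D^{-1} = I + ((2 s^{-1})/(λ − s^{-1}))·(I − DπD^{-1}). -/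
open Matrix

/-- `D k_{1,π}(sλ) D⁻¹ = k_{s⁻¹, DπD⁻¹}(λ)`, explicitly
`D (I + (2/(sλ-1))(I-π)) D⁻¹ = I + ((2s⁻¹)/(λ-s⁻¹)) (I - DπD⁻¹)`. -/
theorem conjugated_simple_element (N : ℕ) (hN : 0 < N)
    (P D : Matrix (Fin N) (Fin N) ℂ) (hD : IsUnit D.det)
    (s : ℂ) (hs : s ≠ 0) (lam : ℂ) (h : s * lam ≠ 1) :
    D * ((1 : Matrix (Fin N) (Fin N) ℂ) + (2 / (s * lam - 1)) • (1 - P)) * D⁻¹ =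
      (1 : Matrix (Fin N) (Fin N) ℂ) +
        ((2 * s⁻¹) / (lam - s⁻¹)) • (1 - D * P * D⁻¹) := by
  have hc : 2 / (s * lam - 1) = (2 * s⁻¹) / (lam - s⁻¹) := by
    have h_den : s * lam - 1 = s * (lam - s⁻¹) := by
      rw [mul_sub, mul_inv_cancel₀ hs]
    rw [h_den, ← div_div, div_eq_mul_inv 2 s]
  rw [hc, Matrix.mul_add, Matrix.add_mul, Matrix.mul_one, Matrix.mul_smul, Matrix.smul_mul,
    Matrix.mul_sub, Matrix.sub_mul, Matrix.mul_one, Matrix.mul_nonsing_inv D hD]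
end

section
/- Let a, b, q₁, r₁ : ℝ² → ℂ be smooth functions of (x,t) satisfying the system (def1Yqrab): a_t = −2 q₁ r₁; b_t = 2 a q₁ r₁ − q₁ₓ r₁ − q₁ r₁ₓ; q₁ₜ = q₁ₓₓₓ − 2(aₓ + b + a²/2) q₁ₓ − q₁ (aₓ + b + a²/2)ₓ; r₁ₜ = r₁ₓₓₓ − 2(aₓ + b + a²/2) r₁ₓ − r₁ (aₓ + b + a²/2)ₓ. Define u₁ := −(aₓ + b + a²/2). Then (u₁, q₁, r₁) satisfies the system (def1Vqru): u₁ₜ = 3 q₁ r₁ₓ + 3 q₁ₓ r₁; q₁ₜ = q₁ₓₓₓ + 2 u₁ q₁ₓ + q₁ u₁ₓ; r₁ₜ = r₁ₓₓₓ + 2 u₁ r₁ₓ + r₁ u₁ₓ. -/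
/-- Partial derivative in the first (spatial) variable of a function `ℝ² → ℂ`
written in curried form. -/
noncomputable def pdx (f : ℝ → ℝ → ℂ) : ℝ → ℝ → ℂ := fun x t => deriv (fun y => f y t) x

/-- Partial derivative in the second (time) variable. -/
noncomputable def pdt (f : ℝ → ℝ → ℂ) : ℝ → ℝ → ℂ := fun x t => deriv (fun s => f x s) t

theorem hasDerivAt_fst_of_differentiable_uncurry {E : Type*} [NormedAddCommGroup E]
    [NormedSpace ℝ E] {f : ℝ × ℝ → E} (hf : Differentiable ℝ f) (x t : ℝ) :
    HasDerivAt (fun y => f (y, t)) (fderiv ℝ f (x, t) (1, 0)) x :=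
  (hf (x, t)).hasFDerivAt.comp_hasDerivAt x ((hasDerivAt_id x).prodMk (hasDerivAt_const x t))

theorem hasDerivAt_snd_of_differentiable_uncurry {E : Type*} [NormedAddCommGroup E]
    [NormedSpace ℝ E] {f : ℝ × ℝ → E} (hf : Differentiable ℝ f) (x t : ℝ) :
    HasDerivAt (fun s => f (x, s)) (fderiv ℝ f (x, t) (0, 1)) t :=
  (hf (x, t)).hasFDerivAt.comp_hasDerivAt t ((hasDerivAt_const t x).prodMk (hasDerivAt_id t))

theorem hasDerivAt_pdx {f : ℝ → ℝ → ℂ} (hf : Differentiable ℝ (Function.uncurry f)) (x t : ℝ) :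
    HasDerivAt (fun y => f y t) (pdx f x t) x :=
  (hasDerivAt_fst_of_differentiable_uncurry hf x t).differentiableAt.hasDerivAt

theorem hasDerivAt_pdt {f : ℝ → ℝ → ℂ} (hf : Differentiable ℝ (Function.uncurry f)) (x t : ℝ) :
    HasDerivAt (fun s => f x s) (pdt f x t) t :=
  (hasDerivAt_snd_of_differentiable_uncurry hf x t).differentiableAt.hasDerivAt

theorem pdx_eq_fderiv {f : ℝ → ℝ → ℂ} (hf : Differentiable ℝ (Function.uncurry f)) (x t : ℝ) :
    pdx f x t = fderiv ℝ (Function.uncurry f) (x, t) (1, 0) :=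
  (hasDerivAt_fst_of_differentiable_uncurry hf x t).deriv

theorem pdt_eq_fderiv {f : ℝ → ℝ → ℂ} (hf : Differentiable ℝ (Function.uncurry f)) (x t : ℝ) :
    pdt f x t = fderiv ℝ (Function.uncurry f) (x, t) (0, 1) :=
  (hasDerivAt_snd_of_differentiable_uncurry hf x t).deriv

/-- Mixed partial derivatives of a `C²` function commute. -/
theorem hasDerivAt_pdx_snd {f : ℝ → ℝ → ℂ} (hf : ContDiff ℝ 2 (Function.uncurry f)) (x t : ℝ) :
    HasDerivAt (fun s => pdx f x s) (pdx (pdt f) x t) t := by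
  have hd : Differentiable ℝ (Function.uncurry f) := hf.differentiable (by norm_num)
  have hd' : Differentiable ℝ (fderiv ℝ (Function.uncurry f)) :=
    (hf.fderiv_right (m := 1) (by norm_num)).differentiable (by norm_num)
  have hx := (hasDerivAt_fst_of_differentiable_uncurry hd' x t).clm_apply
    (hasDerivAt_const x ((0, 1) : ℝ × ℝ))
  have ht := (hasDerivAt_snd_of_differentiable_uncurry hd' x t).clm_apply
    (hasDerivAt_const t ((1, 0) : ℝ × ℝ))
  have hsymm : IsSymmSndFDerivAt ℝ (Function.uncurry f) (x, t) :=
    hf.contDiffAt.isSymmSndFDerivAt (by simp)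
  simp only [← pdx_eq_fderiv hd, ← pdt_eq_fderiv hd, map_zero, add_zero] at hx ht
  have hpdx : pdx (pdt f) x t = _ := hx.deriv
  rw [hpdx, hsymm.eq]
  exact ht

/-- if smooth `(a, b, q₁, r₁)` solves the system (def1Yqrab), then with
`u₁ = -(aₓ + b + a²/2)` the triple `(u₁, q₁, r₁)` solves the system (def1Vqru). -/
theorem gauge_transformation_def1Yqrab_to_def1Vqru
    (a b q₁ r₁ : ℝ → ℝ → ℂ)
    (ha : ContDiff ℝ (⊤ : ℕ∞) (Function.uncurry a)) (hb : ContDiff ℝ (⊤ : ℕ∞) (Function.uncurry b))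
    (hq : ContDiff ℝ (⊤ : ℕ∞) (Function.uncurry q₁)) (hr : ContDiff ℝ (⊤ : ℕ∞) (Function.uncurry r₁))
    (h1 : ∀ x t, pdt a x t = -2 * q₁ x t * r₁ x t)
    (h2 : ∀ x t, pdt b x t =
      2 * a x t * q₁ x t * r₁ x t - pdx q₁ x t * r₁ x t - q₁ x t * pdx r₁ x t)
    (h3 : ∀ x t, pdt q₁ x t = pdx (pdx (pdx q₁)) x t
      - 2 * (pdx a x t + b x t + (a x t)^2 / 2) * pdx q₁ x t
      - q₁ x t * pdx (fun y s => pdx a y s + b y s + (a y s)^2 / 2) x t)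
    (h4 : ∀ x t, pdt r₁ x t = pdx (pdx (pdx r₁)) x t
      - 2 * (pdx a x t + b x t + (a x t)^2 / 2) * pdx r₁ x t
      - r₁ x t * pdx (fun y s => pdx a y s + b y s + (a y s)^2 / 2) x t)
    (u₁ : ℝ → ℝ → ℂ)
    (hu : ∀ x t, u₁ x t = -(pdx a x t + b x t + (a x t)^2 / 2)) :
    (∀ x t, pdt u₁ x t = 3 * q₁ x t * pdx r₁ x t + 3 * pdx q₁ x t * r₁ x t) ∧
    (∀ x t, pdt q₁ x t = pdx (pdx (pdx q₁)) x t
      + 2 * u₁ x t * pdx q₁ x t + q₁ x t * pdx u₁ x t) ∧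
    (∀ x t, pdt r₁ x t = pdx (pdx (pdx r₁)) x t
      + 2 * u₁ x t * pdx r₁ x t + r₁ x t * pdx u₁ x t) := by
  have ha' : Differentiable ℝ (Function.uncurry a) := ha.differentiable (by simp)
  have hb' : Differentiable ℝ (Function.uncurry b) := hb.differentiable (by simp)
  have hq' : Differentiable ℝ (Function.uncurry q₁) := hq.differentiable (by simp)
  have hr' : Differentiable ℝ (Function.uncurry r₁) := hr.differentiable (by simp)
  have hu' : u₁ = fun x t => -(pdx a x t + b x t + (a x t) ^ 2 / 2) := by
    funext x t
    exact hu x t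
  have hux : ∀ x t, pdx u₁ x t =
      -pdx (fun y s => pdx a y s + b y s + (a y s) ^ 2 / 2) x t := by
    intro x t
    rw [hu']
    exact deriv.fun_neg
  refine ⟨fun x t => ?_, fun x t => ?_, fun x t => ?_⟩
  · have hax : pdx (pdt a) x t = -2 * (pdx q₁ x t * r₁ x t + q₁ x t * pdx r₁ x t) := by
      have hfun : pdt a = fun x t => -2 * (q₁ x t * r₁ x t) := by
        funext x t
        rw [h1, mul_assoc]
      rw [hfun]
      exact (((hasDerivAt_pdx hq' x t).mul (hasDerivAt_pdx hr' x t)).const_mul (-2)).deriv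
    have hut : pdt u₁ x t =
        -(pdx (pdt a) x t + pdt b x t + 2 * a x t * pdt a x t / 2) := by
      rw [hu']
      have hsq := ((hasDerivAt_pdt ha' x t).fun_pow 2).div_const 2
      simp only [Nat.cast_ofNat, Nat.add_one_sub_one, pow_one] at hsq
      exact (((hasDerivAt_pdx_snd (contDiff_infty.1 ha 2) x t).add
        (hasDerivAt_pdt hb' x t)).add hsq).neg.deriv
    rw [hut, hax, h1, h2]
    ring
  · rw [h3, hux, hu]
    ring
  · rw [h4, hux, hu]
    ring
end
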